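/- arXiv:math/0703516 — 3 statements merged into one kernel-verified Lean document; each statement's English description precedes it below -/
import Mathlib

section
/- Every member of 𝓕 with at least one node is conjugate in PLF⁺([0,1]) to a corner function. -/
open Set Function

/-- `f` is locally affine at `x`: it agrees with an affine map on a neighbourhood of `x`. -/
def LocallyAffineAt (f : ℝ → ℝ) (x : ℝ) : Prop :=
  ∃ a b : ℝ, ∀ᶠ y in nhds x, f y = a * y + b

/-- `x` is a node of `f`: a point of `(0,1)` at which `f` is not locally affine. -/
def IsNode (f : ℝ → ℝ) (x : ℝ) : Prop :=
  x ∈ Set.Ioo (0 : ℝ) 1 ∧ ¬ LocallyAffineAt f x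

/-- Membership of the group `PLF⁺([0,1])` of orientation-preserving piecewise linear
homeomorphisms of `[0,1]` that are locally affine at all but finitely many points of `(0,1)`.
Such a homeomorphism is modelled as a map `ℝ → ℝ` that equals the identity outside `[0,1]`,
so that composition and (function) inverse model the group structure. -/
structure IsPLF (f : ℝ → ℝ) : Prop where
  map_zero : f 0 = 0
  map_one : f 1 = 1
  strictMonoOn : StrictMonoOn f (Set.Icc 0 1)
  continuousOn : ContinuousOn f (Set.Icc 0 1)
  surjOn : Set.SurjOn f (Set.Icc 0 1) (Set.Icc 0 1)
  eq_id : ∀ x : ℝ, x ∉ Set.Icc (0 : ℝ) 1 → f x = x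
  finite_nodes : {x : ℝ | IsNode f x}.Finite

/-- Membership of `𝓕`: elements of `PLF⁺([0,1])` with `f x > x` on `(0,1)`. -/
def MemF (f : ℝ → ℝ) : Prop :=
  IsPLF f ∧ ∀ x ∈ Set.Ioo (0 : ℝ) 1, x < f x

/-- `f` has at least one node. -/
def HasNode (f : ℝ → ℝ) : Prop := ∃ x, IsNode f x

/-- The left derivative `f'₋(x)`. -/
noncomputable def leftDeriv (f : ℝ → ℝ) (x : ℝ) : ℝ := derivWithin f (Set.Iic x) x

/-- The right derivative `f'₊(x)`. -/
noncomputable def rightDeriv (f : ℝ → ℝ) (x : ℝ) : ℝ := derivWithin f (Set.Ici x) x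

/-- `f*(x) = f'₊(x) / f'₋(x)`. -/
noncomputable def fstar (f : ℝ → ℝ) (x : ℝ) : ℝ := rightDeriv f x / leftDeriv f x

/-- `x_f`, the smallest node of `f` (for `f ∈ 𝓕` with at least one node). -/
noncomputable def firstNode (f : ℝ → ℝ) : ℝ := sInf {x | IsNode f x}

/-- `y_f`, the largest node of `f`. -/
noncomputable def lastNode (f : ℝ → ℝ) : ℝ := sSup {x | IsNode f x}

/-- `α_f = f'₋(x_f)`. -/
noncomputable def alphaF (f : ℝ → ℝ) : ℝ := leftDeriv f (firstNode f)

/-- `φ_f^a(x) = ∏_{n=0}^∞ f*(fⁿ(x))` (independent of `a` as a formula; `a` only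
fixes the domain `[a, f a)`). -/
noncomputable def phi (f : ℝ → ℝ) (x : ℝ) : ℝ := ∏' n : ℕ, fstar f (f^[n] x)

/-- `ψ_f^a(s) = φ_f^a(α_f ^ s * a)`, a function on the circle `𝕊 = [0,1]/(0∼1)`,
represented by its values for `s ∈ [0,1)`. -/
noncomputable def psiA (f : ℝ → ℝ) (a s : ℝ) : ℝ := phi f (alphaF f ^ s * a)

/-- `ψ_f = ψ_f^{x_f}`. -/
noncomputable def psi (f : ℝ → ℝ) (s : ℝ) : ℝ := psiA f (firstNode f) s

/-- `f` and `g` are conjugate in `PLF⁺([0,1])`: `h f h⁻¹ = g` for some `h` in the group. -/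
def IsConjPLF (f g : ℝ → ℝ) : Prop :=
  ∃ h : ℝ → ℝ, IsPLF h ∧ h ∘ f ∘ Function.invFun h = g

/-- A corner function: a member of `𝓕` (with at least one node) all of whose nodes
lie in `[x_f, f x_f)`. -/
def CornerFun (f : ℝ → ℝ) : Prop :=
  MemF f ∧ HasNode f ∧ ∀ x, IsNode f x → x ∈ Set.Ico (firstNode f) (f (firstNode f))


namespace LocallyAffineAt

lemma congr {f g : ℝ → ℝ} {x : ℝ} (hf : LocallyAffineAt f x) (h : g =ᶠ[nhds x] f) :
    LocallyAffineAt g x := by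
  obtain ⟨a, b, hab⟩ := hf
  refine ⟨a, b, ?_⟩
  filter_upwards [hab, h] with y hy hgf
  rw [hgf, hy]

lemma comp {f g : ℝ → ℝ} {x : ℝ} (hf : LocallyAffineAt f (g x)) (hg : LocallyAffineAt g x)
    (hc : ContinuousAt g x) : LocallyAffineAt (f ∘ g) x := by
  obtain ⟨a, b, hab⟩ := hf
  obtain ⟨c, d, hcd⟩ := hg
  refine ⟨a * c, a * d + b, ?_⟩
  filter_upwards [hc.eventually hab, hcd] with y hy hy'
  rw [comp_apply, hy, hy']
  ring

lemma slope_pos {f : ℝ → ℝ} {x a b : ℝ} (hf : StrictMono f)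
    (h : ∀ᶠ y in nhds x, f y = a * y + b) : 0 < a := by
  have hlt := (h.filter_mono nhdsWithin_le_nhds).and (self_mem_nhdsWithin (s := Ioi x))
  obtain ⟨y, hy, hxy⟩ := hlt.exists
  have hxy : x < y := hxy
  have h1 := hf hxy
  rw [hy, h.self_of_nhds] at h1
  by_contra! ha
  nlinarith

lemma rightInverse {f g : ℝ → ℝ} {x : ℝ} (hf : LocallyAffineAt f x) (hmono : StrictMono f)
    (hg : ContinuousAt g (f x)) (hgx : g (f x) = x) (hfg : RightInverse g f) :
    LocallyAffineAt g (f x) := by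
  obtain ⟨a, b, hab⟩ := hf
  have ha := slope_pos hmono hab
  refine ⟨a⁻¹, -(a⁻¹ * b), ?_⟩
  rw [← hgx] at hab
  filter_upwards [hg.eventually hab] with y hy
  rw [hfg y] at hy
  field_simp
  linarith

lemma deriv_deriv_eq_zero {f : ℝ → ℝ} {x : ℝ} (hf : LocallyAffineAt f x) :
    DifferentiableAt ℝ f x ∧ DifferentiableAt ℝ (deriv f) x ∧ deriv (deriv f) x = 0 := by
  obtain ⟨a, b, hab⟩ := hf
  have key : ∀ y, HasDerivAt (fun y => a * y + b) a y := fun y => by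
    simpa using ((hasDerivAt_id y).const_mul a).add_const b
  have h2 : deriv f =ᶠ[nhds x] fun _ => a := by
    filter_upwards [eventually_eventually_nhds.2 hab] with y hy
    exact ((key y).congr_of_eventuallyEq hy).deriv
  have h3 : HasDerivAt (deriv f) 0 x := (hasDerivAt_const x a).congr_of_eventuallyEq h2
  exact ⟨((key x).congr_of_eventuallyEq hab).differentiableAt, h3.differentiableAt, h3.deriv⟩

end LocallyAffineAt

lemma exists_affine_of_locallyAffineAt {f : ℝ → ℝ} {a b : ℝ}
    (hf : ∀ x ∈ Ioo a b, LocallyAffineAt f x) :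
    ∃ p q : ℝ, ∀ x ∈ Ioo a b, f x = p * x + q := by
  obtain ⟨p, hp⟩ := isOpen_Ioo.exists_is_const_of_deriv_eq_zero isPreconnected_Ioo
    (fun x hx => (hf x hx).deriv_deriv_eq_zero.2.1.differentiableWithinAt)
    (fun x hx => (hf x hx).deriv_deriv_eq_zero.2.2)
  have hd : ∀ x ∈ Ioo a b, HasDerivAt (fun x => f x - p * x) 0 x := fun x hx => by
    have h1 := (hf x hx).deriv_deriv_eq_zero.1.hasDerivAt
    rw [hp x hx] at h1
    simpa using h1.fun_sub ((hasDerivAt_id x).const_mul p)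
  obtain ⟨q, hq⟩ := isOpen_Ioo.exists_is_const_of_deriv_eq_zero isPreconnected_Ioo
    (fun x hx => (hd x hx).differentiableAt.differentiableWithinAt)
    (fun x hx => (hd x hx).deriv)
  exact ⟨p, q, fun x hx => by linarith [hq x hx]⟩

namespace IsPLF

variable {f g : ℝ → ℝ}

lemma strictMono (hf : IsPLF f) : StrictMono f := by
  intro x y hxy
  have key : ∀ z ∈ Icc (0 : ℝ) 1, 0 ≤ f z ∧ f z ≤ 1 := fun z hz => by
    have h0 := hf.strictMonoOn.monotoneOn (by simp) hz hz.1
    have h1 := hf.strictMonoOn.monotoneOn hz (by simp) hz.2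
    rw [hf.map_zero] at h0
    rw [hf.map_one] at h1
    exact ⟨h0, h1⟩
  by_cases hx : x ∈ Icc (0 : ℝ) 1 <;> by_cases hy : y ∈ Icc (0 : ℝ) 1
  · exact hf.strictMonoOn hx hy hxy
  · rw [hf.eq_id y hy]
    have : 1 < y := by
      by_contra! h
      exact hy ⟨hx.1.trans hxy.le, h⟩
    linarith [key x hx]
  · rw [hf.eq_id x hx]
    have : x < 0 := by
      by_contra! h
      exact hx ⟨h, hxy.le.trans hy.2⟩
    linarith [key y hy]
  · rwa [hf.eq_id x hx, hf.eq_id y hy]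

lemma surjective (hf : IsPLF f) : Surjective f := by
  intro y
  by_cases hy : y ∈ Icc (0 : ℝ) 1
  · obtain ⟨x, -, hx⟩ := hf.surjOn hy
    exact ⟨x, hx⟩
  · exact ⟨y, hf.eq_id y hy⟩

lemma continuous (hf : IsPLF f) : Continuous f :=
  hf.strictMono.monotone.continuous_of_surjective hf.surjective

lemma of_strictMono (h0 : f 0 = 0) (h1 : f 1 = 1) (hmono : StrictMono f) (hcont : Continuous f)
    (hid : ∀ x : ℝ, x ∉ Icc (0 : ℝ) 1 → f x = x) (hfin : {x : ℝ | IsNode f x}.Finite) :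
    IsPLF f where
  map_zero := h0
  map_one := h1
  strictMonoOn := hmono.strictMonoOn _
  continuousOn := hcont.continuousOn
  surjOn := by
    have := intermediate_value_Icc (zero_le_one (α := ℝ)) hcont.continuousOn
    rwa [h0, h1] at this
  eq_id := hid
  finite_nodes := hfin

lemma mem_Ioo_iff (hf : IsPLF f) {x : ℝ} : f x ∈ Ioo (0 : ℝ) 1 ↔ x ∈ Ioo (0 : ℝ) 1 := by
  have h0 := hf.strictMono.lt_iff_lt (a := 0) (b := x)
  have h1 := hf.strictMono.lt_iff_lt (a := x) (b := 1)
  rw [hf.map_zero] at h0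
  rw [hf.map_one] at h1
  rw [mem_Ioo, mem_Ioo, h0, h1]

lemma mem_Icc_iff (hf : IsPLF f) {x : ℝ} : f x ∈ Icc (0 : ℝ) 1 ↔ x ∈ Icc (0 : ℝ) 1 := by
  have h0 := hf.strictMono.le_iff_le (a := 0) (b := x)
  have h1 := hf.strictMono.le_iff_le (a := x) (b := 1)
  rw [hf.map_zero] at h0
  rw [hf.map_one] at h1
  rw [mem_Icc, mem_Icc, h0, h1]

protected lemma id : IsPLF id := by
  refine of_strictMono rfl rfl strictMono_id continuous_id (fun _ _ => rfl) ?_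
  convert Set.finite_empty (α := ℝ)
  ext x
  simp only [mem_ofPred_eq, mem_empty_iff_false, iff_false]
  exact fun h => h.2 ⟨1, 0, by simp⟩

protected lemma comp (hf : IsPLF f) (hg : IsPLF g) : IsPLF (f ∘ g) := by
  refine of_strictMono (by simp [hf.map_zero, hg.map_zero]) (by simp [hf.map_one, hg.map_one])
    (hf.strictMono.comp hg.strictMono) (hf.continuous.comp hg.continuous)
    (fun x hx => by rw [comp_apply, hg.eq_id x hx, hf.eq_id x hx]) ?_
  refine (hg.finite_nodes.union
    (hf.finite_nodes.preimage (hg.strictMono.injective.injOn))).subset ?_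
  rintro x ⟨hx, hn⟩
  by_contra hcon
  simp only [mem_union, mem_ofPred_eq, mem_preimage, not_or, IsNode, not_and, not_not] at hcon
  exact hn ((hcon.2 (hg.mem_Ioo_iff.2 hx)).comp (hcon.1 hx) hg.continuous.continuousAt)

lemma leftInverse_invFun (hf : IsPLF f) : LeftInverse (invFun f) f :=
  Function.leftInverse_invFun hf.strictMono.injective

lemma rightInverse_invFun (hf : IsPLF f) : RightInverse (invFun f) f :=
  Function.rightInverse_invFun hf.surjective

protected lemma invFun (hf : IsPLF f) : IsPLF (invFun f) := by
  have hl := hf.leftInverse_invFun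
  have hr := hf.rightInverse_invFun
  have hmono : StrictMono (invFun f) := fun x y hxy => by
    rwa [← hf.strictMono.lt_iff_lt, hr, hr]
  have hcont := hmono.monotone.continuous_of_surjective hl.surjective
  refine of_strictMono ?_ ?_ hmono hcont ?_ ?_
  · simpa [hf.map_zero] using hl 0
  · simpa [hf.map_one] using hl 1
  · intro x hx
    simpa [hf.eq_id x hx] using hl x
  · refine (hf.finite_nodes.image f).subset ?_
    rintro y ⟨hy, hn⟩
    obtain ⟨x, rfl⟩ := hf.surjective y
    refine ⟨x, ⟨hf.mem_Ioo_iff.1 hy, fun h => hn ?_⟩, rfl⟩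
    exact h.rightInverse hf.strictMono hcont.continuousAt (hl x) hr

protected lemma iterate (hf : IsPLF f) (n : ℕ) : IsPLF f^[n] := by
  induction n with
  | zero => exact IsPLF.id
  | succ n ih => exact ih.comp hf

/-- Continue `k` affinely to the right of a non-node `c`, then rescale the image to `[0,1]`. -/
lemma exists_affine_right {k : ℝ → ℝ} (hk : IsPLF k) {c : ℝ} (hc : c ∈ Ioo (0 : ℝ) 1)
    (hkc : LocallyAffineAt k c) :
    ∃ (h : ℝ → ℝ) (M : ℝ), IsPLF h ∧ 0 < M ∧ (∀ x ∈ Icc 0 c, h x = k x / M) ∧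
      ∀ x ∈ Ico c 1, LocallyAffineAt h x := by
  obtain ⟨p, q, hpq⟩ := hkc
  have hp := LocallyAffineAt.slope_pos hk.strictMono hpq
  have hkc : k c = p * c + q := hpq.self_of_nhds
  let u : ℝ → ℝ := fun x => if x ≤ c then k x else p * x + q
  have hule : ∀ x ≤ c, u x = k x := fun x hx => if_pos hx
  have huge : ∀ x, c ≤ x → u x = p * x + q := fun x hx => by
    rcases hx.eq_or_lt with rfl | hx
    · rw [hule _ le_rfl, hkc]
    · exact if_neg (not_le.2 hx)
  have hu : StrictMono u := by
    intro x y hxy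
    rcases le_total y c with hy | hy
    · rw [hule y hy, hule x (hxy.le.trans hy)]
      exact hk.strictMono hxy
    · rw [huge y hy]
      rcases le_total x c with hx | hx
      · rw [hule x hx]
        have h1 := hk.strictMono.monotone hx
        rcases hx.eq_or_lt with rfl | hx'
        · nlinarith
        · have := hk.strictMono hx'
          nlinarith
      · rw [huge x hx]
        nlinarith
  have hucont : Continuous u := by
    refine Continuous.if_le hk.continuous (by fun_prop) continuous_id continuous_const ?_
    rintro x rfl
    exact hkc
  have hu0 : u 0 = 0 := by rw [hule 0 hc.1.le, hk.map_zero]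
  have hM : 0 < u 1 := hu0 ▸ hu one_pos
  have hulin : ∀ x, c ≤ x → LocallyAffineAt u x := by
    intro x hx
    refine ⟨p, q, ?_⟩
    rcases hx.eq_or_lt with rfl | hx
    · filter_upwards [hpq] with y hy
      rcases le_total y c with h | h
      · rw [hule y h, hy]
      · exact huge y h
    · filter_upwards [Ioi_mem_nhds hx] with y hy
      exact huge y (le_of_lt hy)
  let h : ℝ → ℝ := fun x => if x ∈ Icc (0 : ℝ) 1 then u x / u 1 else x
  have hin : ∀ x ∈ Icc (0 : ℝ) 1, h x = u x / u 1 := fun x hx => if_pos hx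
  have hlin : ∀ x ∈ Ioo (0 : ℝ) 1, LocallyAffineAt u x → LocallyAffineAt h x := by
    rintro x hx ⟨a, b, hab⟩
    refine ⟨a / u 1, b / u 1, ?_⟩
    filter_upwards [hab, Icc_mem_nhds hx.1 hx.2] with y hy hy1
    rw [hin y hy1, hy]
    ring
  have h0 : h 0 = 0 := by rw [hin 0 (by simp), hu0, zero_div]
  have h1 : h 1 = 1 := by rw [hin 1 (by simp), div_self hM.ne']
  refine ⟨h, u 1, ?_, hM, ?_, ?_⟩
  · refine ⟨h0, h1, ?_, ?_, ?_, fun x hx => if_neg hx, ?_⟩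
    · intro x hx y hy hxy
      rw [hin x hx, hin y hy]
      exact div_lt_div_of_pos_right (hu hxy) hM
    · exact (hucont.div_const _).continuousOn.congr hin
    · have := intermediate_value_Icc (zero_le_one (α := ℝ))
        ((hucont.div_const (u 1)).continuousOn.congr hin)
      rwa [h0, h1] at this
    · refine hk.finite_nodes.subset ?_
      rintro x ⟨hx, hn⟩
      refine ⟨hx, fun hkx => hn (hlin x hx ?_)⟩
      rcases le_or_gt c x with hcx | hcx
      · exact hulin x hcx
      · refine hkx.congr ?_
        filter_upwards [Iio_mem_nhds hcx] with y hy
        exact hule y (le_of_lt hy)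
  · intro x hx
    rw [hin x ⟨hx.1, hx.2.trans hc.2.le⟩, hule x hx.2]
  · intro x hx
    exact hlin x ⟨hc.1.trans_le hx.1, hx.2⟩ (hulin x hx.1)

end IsPLF

namespace MemF

variable {f h : ℝ → ℝ}

lemma exists_lt_iterate (hf : MemF f) {x y : ℝ} (hx : x ∈ Ioo (0 : ℝ) 1) (hy : y < 1) :
    ∃ n : ℕ, y < f^[n] x := by
  by_contra! hle
  have hmem : ∀ n, f^[n] x ∈ Ioo (0 : ℝ) 1 := fun n => (hf.1.iterate n).mem_Ioo_iff.2 hx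
  have hmono : Monotone fun n => f^[n] x := monotone_nat_of_le_succ fun n => by
    rw [iterate_succ_apply']
    exact (hf.2 _ (hmem n)).le
  have hbdd : BddAbove (range fun n => f^[n] x) := ⟨y, by rintro _ ⟨n, rfl⟩; exact hle n⟩
  have ht := tendsto_atTop_ciSup hmono hbdd
  set l := ⨆ n, f^[n] x
  have hfix : f l = l := isFixedPt_of_tendsto_iterate ht hf.1.continuous.continuousAt
  have hxl : x ≤ l := le_ciSup hbdd 0
  have hly : l ≤ y := ciSup_le hle
  exact (hf.2 l ⟨hx.1.trans_le hxl, hly.trans_lt hy⟩).ne' hfix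

lemma hasNode (hf : MemF f) : HasNode f := by
  by_contra hno
  obtain ⟨p, q, hpq⟩ := exists_affine_of_locallyAffineAt (f := f) (a := 0) (b := 1)
    fun x hx => by_contra fun hn => hno ⟨x, hx, hn⟩
  have hcl : EqOn f (fun x => p * x + q) (closure (Ioo 0 1)) :=
    EqOn.closure hpq hf.1.continuous (by fun_prop)
  rw [closure_Ioo zero_ne_one] at hcl
  have h0 := hcl (x := 0) (by simp)
  have h1 := hcl (x := 1) (by simp)
  have h2 := hcl (x := 1 / 2) (by norm_num)
  have h3 := hf.2 (1 / 2) (by norm_num)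
  simp only [hf.1.map_zero, hf.1.map_one] at h0 h1 h2
  linarith

lemma conj (hf : MemF f) (hh : IsPLF h) : MemF (h ∘ f ∘ invFun h) := by
  refine ⟨hh.comp (hf.1.comp hh.invFun), fun y hy => ?_⟩
  obtain ⟨x, rfl⟩ := hh.surjective y
  simp only [comp_apply, hh.leftInverse_invFun x]
  exact hh.strictMono (hf.2 x (hh.mem_Ioo_iff.1 hy))

lemma cornerFun_of_nodes (hf : MemF f) {a : ℝ} (hnode : ∀ x, IsNode f x → x ∈ Ico a (f a)) :
    CornerFun f := by
  refine ⟨hf, hf.hasNode, fun x hx => ⟨csInf_le ⟨a, fun y hy => (hnode y hy).1⟩ hx, ?_⟩⟩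
  have : a ≤ firstNode f := le_csInf hf.hasNode fun y hy => (hnode y hy).1
  exact (hnode x hx).2.trans_le (hf.1.strictMono.monotone this)

end MemF

/-- **Lemma 3.** Every member of `𝓕` with at least one node is conjugate in
`PLF⁺([0,1])` to a corner function. -/
theorem conj_to_corner (f : ℝ → ℝ) (hf : MemF f) (hfn : HasNode f) :
    ∃ g : ℝ → ℝ, CornerFun g ∧ IsConjPLF f g := by
  obtain ⟨x₀, hx₀, hmin⟩ := Set.exists_min_image _ id hf.1.finite_nodes hfn
  obtain ⟨y₀, hy₀, hmax⟩ := Set.exists_max_image _ id hf.1.finite_nodes hfn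
  obtain ⟨n, hn⟩ := hf.exists_lt_iterate hx₀.1 hy₀.1.2
  have hfi := hf.1.iterate n
  set k := invFun f^[n] with hkdef
  have hk : IsPLF k := hfi.invFun
  have hcomm : ∀ x, k (f x) = f (k x) := fun x => by
    apply hfi.strictMono.injective
    rw [hfi.rightInverse_invFun, (Commute.iterate_self f n) (k x), hfi.rightInverse_invFun]
  -- a fundamental domain `[a, f a)` to the right of all nodes, with `f a` not a node of `k`
  obtain ⟨a, ha, hka⟩ : ∃ a ∈ Ioo y₀ (f^[n] x₀), ¬ IsNode k (f a) := by
    by_contra! hcon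
    exact Ioo_infinite hn
      ((hk.finite_nodes.preimage hf.1.strictMono.injective.injOn).subset hcon)
  have ha01 : a ∈ Ioo (0 : ℝ) 1 :=
    ⟨hy₀.1.1.trans ha.1, ha.2.trans (hfi.mem_Ioo_iff.2 hx₀.1).2⟩
  have hc01 := hf.1.mem_Ioo_iff.2 ha01
  obtain ⟨h, M, hh, hM, hhk, hlin⟩ :=
    hk.exists_affine_right hc01 (by_contra fun hcon => hka ⟨hc01, hcon⟩)
  refine ⟨h ∘ f ∘ invFun h, (hf.conj hh).cornerFun_of_nodes (a := h a) ?_, h, hh, rfl⟩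
  rintro y ⟨hy, hnode⟩
  obtain ⟨x, rfl⟩ := hh.surjective y
  have hx := hh.mem_Ioo_iff.1 hy
  simp only [mem_Ico, comp_apply, hh.leftInverse_invFun a, hh.strictMono.le_iff_le,
    hh.strictMono.lt_iff_lt]
  have hcont : ContinuousAt (invFun h) (h x) := hh.invFun.continuous.continuousAt
  refine ⟨?_, ?_⟩
  · by_contra! hxa
    have hkx : k x < x₀ := by
      have := hk.strictMono (hxa.trans ha.2)
      rwa [hkdef, hfi.leftInverse_invFun] at this
    obtain ⟨p, q, hpq⟩ : LocallyAffineAt f (k x) := by_contra fun hcon =>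
      (hmin _ ⟨hk.mem_Ioo_iff.2 hx, hcon⟩).not_gt hkx
    refine hnode ⟨p, q / M, ?_⟩
    have hev : ∀ᶠ z in nhds x, h (f z) = p * h z + q / M := by
      filter_upwards [hk.continuous.continuousAt.eventually hpq,
        Ioo_mem_nhds hx.1 hxa] with z hz hz'
      have hfz := hf.1.strictMono hz'.2
      have hz1 := hf.2 z ⟨hz'.1, hz'.2.trans ha01.2⟩
      rw [hhk z ⟨hz'.1.le, (hz1.trans hfz).le⟩, hhk (f z) ⟨(hz'.1.trans hz1).le, hfz.le⟩,
        hcomm, hz]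
      ring
    rw [← hh.leftInverse_invFun x] at hev
    filter_upwards [hcont.eventually hev] with y hy'
    rw [comp_apply, comp_apply, hy', hh.rightInverse_invFun]
  · by_contra! hxc
    have hhx := hlin x ⟨hxc, hx.2⟩
    have hhfx := hlin (f x) ⟨hxc.trans (hf.2 x hx).le, (hf.1.mem_Ioo_iff.2 hx).2⟩
    have hfx : LocallyAffineAt f x := by_contra fun hcon =>
      (hmax x ⟨hx, hcon⟩).not_gt (ha.1.trans ((hf.2 a ha01).trans_le hxc))
    have hinv := hhx.rightInverse hh.strictMono hcont (hh.leftInverse_invFun x)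
      hh.rightInverse_invFun
    refine hnode (LocallyAffineAt.comp (g := f ∘ invFun h) ?_
      (LocallyAffineAt.comp ?_ hinv hcont) (hf.1.continuous.continuousAt.comp hcont))
    · rwa [comp_apply, hh.leftInverse_invFun]
    · rwa [hh.leftInverse_invFun]
end

section
/- A corner function is uniquely specified by α and ψ: if f and g are corner functions with α_f = α_g and ψ_f = ψ_g, then f = g. -/
open Set Function

theorem exists_affine_of_forall_locallyAffineAt {f : ℝ → ℝ} {p q : ℝ} (hpq : p < q)
    (hf : ∀ x ∈ Ioo p q, LocallyAffineAt f x) (hc : ContinuousOn f (Icc p q)) :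
    ∃ a b : ℝ, ∀ x ∈ Icc p q, f x = a * x + b := by
  have hderiv {x a b : ℝ} (h : ∀ᶠ y in nhds x, f y = a * y + b) : HasDerivAt f a x := by
    have h1 : HasDerivAt (fun y : ℝ => a * y + b) a x := by
      simpa using ((hasDerivAt_id x).const_mul a).add_const b
    exact h1.congr_of_eventuallyEq h
  have hdd : ∀ x ∈ Ioo p q, HasDerivAt (deriv f) 0 x := by
    intro x hx
    obtain ⟨a, b, h⟩ := hf x hx
    refine (hasDerivAt_const x a).congr_of_eventuallyEq ?_
    filter_upwards [h.eventually_nhds] with y hy using (hderiv hy).deriv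
  obtain ⟨a, hA⟩ := isOpen_Ioo.exists_is_const_of_deriv_eq_zero isPreconnected_Ioo
    (fun x hx => (hdd x hx).differentiableAt.differentiableWithinAt)
    (fun x hx => (hdd x hx).deriv)
  have hd : ∀ x ∈ Ioo p q, HasDerivAt (fun y => f y - a * y) 0 x := by
    intro x hx
    obtain ⟨a', b, h⟩ := hf x hx
    have h2 := hderiv h
    have h3 : a' = a := h2.deriv.symm.trans (hA x hx)
    subst h3
    simpa using h2.fun_sub ((hasDerivAt_id x).const_mul a')
  obtain ⟨b, hB⟩ := isOpen_Ioo.exists_is_const_of_deriv_eq_zero isPreconnected_Ioo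
    (fun x hx => (hd x hx).differentiableAt.differentiableWithinAt)
    (fun x hx => (hd x hx).deriv)
  refine ⟨a, b, ?_⟩
  have hE : EqOn f (fun x => a * x + b) (Ioo p q) := fun x hx => by
    have := hB x hx
    simp only at this ⊢
    linarith
  exact hE.of_subset_closure hc (by fun_prop) Ioo_subset_Icc_self
    (closure_Ioo hpq.ne).ge

theorem leftDeriv_eq_of_eqOn {f : ℝ → ℝ} {p x a b : ℝ} (hp : p < x)
    (h : ∀ y ∈ Icc p x, f y = a * y + b) : leftDeriv f x = a := by
  have h1 : HasDerivAt (fun y : ℝ => a * y + b) a x := by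
    simpa using ((hasDerivAt_id x).const_mul a).add_const b
  refine (h1.hasDerivWithinAt.congr_of_eventuallyEq ?_
    (h x ⟨hp.le, le_rfl⟩)).derivWithin (uniqueDiffOn_Iic x x self_mem_Iic)
  filter_upwards [Icc_mem_nhdsLE hp] with y hy using h y hy

theorem rightDeriv_eq_of_eqOn {f : ℝ → ℝ} {q x a b : ℝ} (hq : x < q)
    (h : ∀ y ∈ Icc x q, f y = a * y + b) : rightDeriv f x = a := by
  have h1 : HasDerivAt (fun y : ℝ => a * y + b) a x := by
    simpa using ((hasDerivAt_id x).const_mul a).add_const b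
  refine (h1.hasDerivWithinAt.congr_of_eventuallyEq ?_
    (h x ⟨le_rfl, hq.le⟩)).derivWithin (uniqueDiffOn_Ici x x self_mem_Ici)
  filter_upwards [Icc_mem_nhdsGE hq] with y hy using h y hy

namespace IsPLF

variable {f : ℝ → ℝ}

theorem exists_affine_of_forall_not_isNode (hf : IsPLF f) {p q : ℝ} (hp : 0 ≤ p) (hq : q ≤ 1)
    (hpq : p < q) (h : ∀ x ∈ Ioo p q, ¬ IsNode f x) :
    ∃ a b : ℝ, ∀ x ∈ Icc p q, f x = a * x + b := by
  refine exists_affine_of_forall_locallyAffineAt hpq (fun x hx => ?_)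
    (hf.continuousOn.mono (Icc_subset_Icc hp hq))
  by_contra hn
  exact h x hx ⟨⟨hp.trans_lt hx.1, hx.2.trans_le hq⟩, hn⟩

theorem exists_forall_not_isNode (hf : IsPLF f) (x : ℝ) :
    ∃ ε > 0, ∀ y, |y - x| < ε → y ≠ x → ¬ IsNode f y := by
  have hS : IsClosed ({y | IsNode f y} \ {x}) := (hf.finite_nodes.subset sdiff_subset).isClosed
  obtain ⟨ε, hε, h⟩ := Metric.isOpen_iff.1 hS.isOpen_compl x (by simp)
  exact ⟨ε, hε, fun y hy hne hN => h (show y ∈ Metric.ball x ε from hy) ⟨hN, hne⟩⟩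

theorem exists_left_affine (hf : IsPLF f) {x : ℝ} (hx : x ∈ Ioc (0 : ℝ) 1) :
    0 < leftDeriv f x ∧ ∃ p ∈ Ico 0 x, ∀ y ∈ Icc p x, f y = f x + leftDeriv f x * (y - x) := by
  obtain ⟨ε, hε, h⟩ := hf.exists_forall_not_isNode x
  have hp0 : 0 ≤ max 0 (x - ε) := le_max_left _ _
  have hpx : max 0 (x - ε) < x := max_lt hx.1 (by linarith)
  have hpε : x - ε ≤ max 0 (x - ε) := le_max_right _ _
  obtain ⟨a, b, hab⟩ := hf.exists_affine_of_forall_not_isNode hp0 hx.2 hpx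
    (fun y hy => h y (by rw [abs_lt]; constructor <;> linarith [hy.1, hy.2]) hy.2.ne)
  rw [leftDeriv_eq_of_eqOn hpx hab]
  have hfx := hab x ⟨hpx.le, le_rfl⟩
  refine ⟨?_, _, ⟨hp0, hpx⟩, fun y hy => by rw [hab y hy, hfx]; ring⟩
  have hlt := hf.strictMonoOn ⟨hp0, hpx.le.trans hx.2⟩ ⟨hx.1.le, hx.2⟩ hpx
  rw [hab _ ⟨le_rfl, hpx.le⟩, hfx] at hlt
  by_contra hn
  nlinarith

theorem exists_right_affine (hf : IsPLF f) {x : ℝ} (hx : x ∈ Ico (0 : ℝ) 1) :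
    ∃ q ∈ Ioc x 1, ∀ y ∈ Icc x q, f y = f x + rightDeriv f x * (y - x) := by
  obtain ⟨ε, hε, h⟩ := hf.exists_forall_not_isNode x
  have hq1 : min 1 (x + ε) ≤ 1 := min_le_left _ _
  have hxq : x < min 1 (x + ε) := lt_min hx.2 (by linarith)
  have hqε : min 1 (x + ε) ≤ x + ε := min_le_right _ _
  obtain ⟨a, b, hab⟩ := hf.exists_affine_of_forall_not_isNode hx.1 hq1 hxq
    (fun y hy => h y (by rw [abs_lt]; constructor <;> linarith [hy.1, hy.2]) hy.1.ne')
  rw [rightDeriv_eq_of_eqOn hxq hab]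
  exact ⟨_, ⟨hxq, hq1⟩, fun y hy => by rw [hab y hy, hab x ⟨le_rfl, hxq.le⟩]; ring⟩

theorem fstar_eq_one (hf : IsPLF f) {x : ℝ} (hx : x ∈ Ioo (0 : ℝ) 1) (hn : ¬ IsNode f x) :
    fstar f x = 1 := by
  have hpos := (hf.exists_left_affine ⟨hx.1, hx.2.le⟩).1
  obtain ⟨a, b, h⟩ : LocallyAffineAt f x := by
    by_contra h
    exact hn ⟨hx, h⟩
  have h1 : HasDerivAt (fun y : ℝ => a * y + b) a x := by
    simpa using ((hasDerivAt_id x).const_mul a).add_const b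
  have h2 : HasDerivAt f a x := h1.congr_of_eventuallyEq h
  have hl : leftDeriv f x = a :=
    h2.hasDerivWithinAt.derivWithin (uniqueDiffOn_Iic x x self_mem_Iic)
  have hr : rightDeriv f x = a :=
    h2.hasDerivWithinAt.derivWithin (uniqueDiffOn_Ici x x self_mem_Ici)
  rw [fstar, hl, hr]
  exact div_self (hl ▸ hpos.ne')

theorem map_mem_Ioo (hf : IsPLF f) {x : ℝ} (hx : x ∈ Ioo (0 : ℝ) 1) : f x ∈ Ioo (0 : ℝ) 1 := by
  have h0 := hf.strictMonoOn ⟨le_rfl, zero_le_one⟩ ⟨hx.1.le, hx.2.le⟩ hx.1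
  have h1 := hf.strictMonoOn ⟨hx.1.le, hx.2.le⟩ ⟨zero_le_one, le_rfl⟩ hx.2
  rw [hf.map_zero] at h0
  rw [hf.map_one] at h1
  exact ⟨h0, h1⟩

end IsPLF

namespace CornerFun

variable {f g : ℝ → ℝ}

theorem firstNode_mem_Ioo (hf : CornerFun f) : firstNode f ∈ Ioo (0 : ℝ) 1 :=
  (show IsNode f (firstNode f) from Nonempty.csInf_mem hf.2.1 hf.1.1.finite_nodes).1

theorem eq_alphaF_mul (hf : CornerFun f) {x : ℝ} (hx : x ∈ Icc 0 (firstNode f)) :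
    f x = alphaF f * x := by
  have hx₁ := hf.firstNode_mem_Ioo
  obtain ⟨a, b, hab⟩ := hf.1.1.exists_affine_of_forall_not_isNode le_rfl hx₁.2.le hx₁.1
    (fun y hy hN => hy.2.not_ge (hf.2.2 y hN).1)
  have hb := hab 0 ⟨le_rfl, hx₁.1.le⟩
  rw [hf.1.1.map_zero] at hb
  rw [alphaF, leftDeriv_eq_of_eqOn hx₁.1 hab, hab x hx]
  linarith

theorem map_firstNode (hf : CornerFun f) : f (firstNode f) = alphaF f * firstNode f :=
  hf.eq_alphaF_mul ⟨hf.firstNode_mem_Ioo.1.le, le_rfl⟩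

theorem one_lt_alphaF (hf : CornerFun f) : 1 < alphaF f := by
  have hx := hf.firstNode_mem_Ioo
  have h := hf.1.2 _ hx
  rw [hf.map_firstNode] at h
  by_contra hn
  nlinarith [hx.1]

theorem fstar_eq_one_of_le (hf : CornerFun f) {x : ℝ} (hx : f (firstNode f) ≤ x) (hx1 : x < 1) :
    fstar f x = 1 :=
  hf.1.1.fstar_eq_one ⟨(hf.1.1.map_mem_Ioo hf.firstNode_mem_Ioo).1.trans_le hx, hx1⟩
    (fun hN => (hf.2.2 x hN).2.not_ge hx)

theorem phi_eq_fstar (hf : CornerFun f) {x : ℝ} (hx : x ∈ Ico (firstNode f) 1) :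
    phi f x = fstar f x := by
  have hx₁ := hf.firstNode_mem_Ioo
  have key : ∀ n : ℕ, f^[n + 1] x ∈ Ico (f (firstNode f)) 1 := by
    intro n
    induction n with
    | zero =>
      exact ⟨hf.1.1.strictMonoOn.monotoneOn ⟨hx₁.1.le, hx₁.2.le⟩
        ⟨hx₁.1.le.trans hx.1, hx.2.le⟩ hx.1, (hf.1.1.map_mem_Ioo ⟨hx₁.1.trans_le hx.1, hx.2⟩).2⟩
    | succ n ih =>
      rw [Function.iterate_succ_apply']
      have hm : f^[n + 1] x ∈ Ioo (0 : ℝ) 1 :=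
        ⟨(hf.1.1.map_mem_Ioo hx₁).1.trans_le ih.1, ih.2⟩
      exact ⟨ih.1.trans (hf.1.2 _ hm).le, (hf.1.1.map_mem_Ioo hm).2⟩
  rw [phi, tprod_eq_mulSingle 0]
  · rfl
  · intro n hn
    obtain ⟨m, rfl⟩ := Nat.exists_eq_succ_of_ne_zero hn
    exact hf.fstar_eq_one_of_le (key m).1 (key m).2

/-- The rescaling taking the first node of `f` to that of `g` matches the slope ratios. -/
theorem fstar_eq_fstar_mul (hf : CornerFun f) (hg : CornerFun g) (ha : alphaF f = alphaF g)
    (hpsi : ∀ s ∈ Ico (0 : ℝ) 1, psi f s = psi g s) {c x : ℝ}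
    (hc : 1 ≤ c) (hcg : firstNode g = c * firstNode f) (hx : firstNode f ≤ x) (hx1 : c * x < 1) :
    fstar f x = fstar g (c * x) := by
  have hx₁ := hf.firstNode_mem_Ioo
  have hα := hf.one_lt_alphaF
  have hxc : x ≤ c * x := le_mul_of_one_le_left (hx₁.1.le.trans hx) hc
  have hgx : firstNode g ≤ c * x := by rw [hcg]; gcongr
  rcases le_or_gt (f (firstNode f)) x with h | h
  · rw [hf.fstar_eq_one_of_le h (hxc.trans_lt hx1), hg.fstar_eq_one_of_le _ hx1]
    rw [hf.map_firstNode] at h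
    rw [hg.map_firstNode, ← ha, hcg]
    nlinarith
  · rw [hf.map_firstNode] at h
    have hr1 : 1 ≤ x / firstNode f := (one_le_div hx₁.1).2 hx
    have hr2 : x / firstNode f < alphaF f := (div_lt_iff₀ hx₁.1).2 h
    have hs := hpsi (Real.logb (alphaF f) (x / firstNode f)) ⟨Real.logb_nonneg hα hr1, by
      rw [Real.logb_lt_iff_lt_rpow hα (by linarith)]; simpa using hr2⟩
    have hpow : alphaF f ^ Real.logb (alphaF f) (x / firstNode f) = x / firstNode f :=
      Real.rpow_logb (by linarith) hα.ne' (by linarith)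
    rw [psi, psi, psiA, psiA, ← ha, hpow, hcg, div_mul_cancel₀ _ hx₁.1.ne',
      show x / firstNode f * (c * firstNode f) = c * x by field_simp [hx₁.1.ne'],
      hf.phi_eq_fstar ⟨hx, hxc.trans_lt hx1⟩, hg.phi_eq_fstar ⟨hgx, hx1⟩] at hs
    exact hs

theorem mul_eq_map_mul (hf : CornerFun f) (hg : CornerFun g) (ha : alphaF f = alphaF g)
    (hpsi : ∀ s ∈ Ico (0 : ℝ) 1, psi f s = psi g s) {c : ℝ}
    (hc : 1 ≤ c) (hcg : firstNode g = c * firstNode f) {x : ℝ} (hx : x ∈ Icc 0 (1 / c)) :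
    c * f x = g (c * x) := by
  have hx₁ := hf.firstNode_mem_Ioo
  have hc0 : 0 < c := by linarith
  have hcinv : 1 / c ≤ 1 := (div_le_one hc0).2 hc
  have hcb : ∀ {y : ℝ}, y ≤ 1 / c → c * y ≤ 1 := fun h => by
    rwa [le_div_iff₀ hc0, mul_comm] at h
  have hbelow : ∀ y ∈ Icc 0 (firstNode f), c * f y = g (c * y) := by
    intro y hy
    rw [hf.eq_alphaF_mul hy, hg.eq_alphaF_mul ⟨mul_nonneg hc0.le hy.1, by
      rw [hcg]; exact mul_le_mul_of_nonneg_left hy.2 hc0.le⟩, ← ha]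
    ring
  have hcontf : ContinuousOn (fun y => c * f y) (Icc 0 (1 / c)) :=
    (hf.1.1.continuousOn.mono (Icc_subset_Icc le_rfl hcinv)).const_mul c
  have hcontg : ContinuousOn (fun y => g (c * y)) (Icc 0 (1 / c)) :=
    hg.1.1.continuousOn.comp (by fun_prop)
      (fun y hy => ⟨mul_nonneg hc0.le hy.1, hcb hy.2⟩)
  let s : Set ℝ := {t | ∀ y ∈ Icc 0 t, c * f y = g (c * y)}
  have hclosed : IsClosed (s ∩ Icc (firstNode f) (1 / c)) := by
    refine isClosed_of_closure_subset fun t ht => ?_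
    have htI : t ∈ Icc (firstNode f) (1 / c) :=
      isClosed_Icc.closure_subset (closure_mono inter_subset_right ht)
    refine ⟨?_, htI⟩
    have ht0 : 0 < t := hx₁.1.trans_le htI.1
    have hE : EqOn (fun y => c * f y) (fun y => g (c * y)) (Ioo 0 t) := by
      intro y hy
      obtain ⟨u, hu, hus⟩ := mem_closure_iff.1 ht (Ioi y) isOpen_Ioi hy.2
      exact hus.1 y ⟨hy.1.le, le_of_lt hu⟩
    exact hE.of_subset_closure (hcontf.mono (Icc_subset_Icc le_rfl htI.2))
      (hcontg.mono (Icc_subset_Icc le_rfl htI.2)) Ioo_subset_Icc_self (closure_Ioo ht0.ne).ge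
  have hsub : Icc (firstNode f) (1 / c) ⊆ s := by
    refine hclosed.Icc_subset_of_forall_exists_gt hbelow ?_
    rintro t ⟨hts, ht⟩ z hz
    have ht0 : 0 < t := hx₁.1.trans_le ht.1
    have hct0 : 0 < c * t := mul_pos hc0 ht0
    have ht1 : t < 1 := ht.2.trans_le hcinv
    have hct1 : c * t < 1 := by
      have := ht.2
      rwa [lt_div_iff₀ hc0, mul_comm] at this
    obtain ⟨hlf, p, hp, hpf⟩ := hf.1.1.exists_left_affine ⟨ht0, ht1.le⟩
    obtain ⟨hlg, p', hp', hpg⟩ := hg.1.1.exists_left_affine ⟨hct0, hct1.le⟩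
    obtain ⟨q, hq, hqf⟩ := hf.1.1.exists_right_affine ⟨ht0.le, ht1⟩
    obtain ⟨q', hq', hqg⟩ := hg.1.1.exists_right_affine ⟨hct0.le, hct1⟩
    have htt := hts t ⟨ht0.le, le_rfl⟩
    have hleft : leftDeriv f t = leftDeriv g (c * t) := by
      have hp't : p' / c < t := by rw [div_lt_iff₀ hc0, mul_comm]; exact hp'.2
      have hut : max p (p' / c) < t := max_lt hp.2 hp't
      have hup : p ≤ max p (p' / c) := le_max_left _ _
      have hup' : p' ≤ c * max p (p' / c) := by
        rw [← div_le_iff₀' hc0]; exact le_max_right _ _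
      set u := max p (p' / c)
      have h1 := hts u ⟨hp.1.trans hup, hut.le⟩
      rw [hpf u ⟨hup, hut.le⟩,
        hpg (c * u) ⟨hup', mul_le_mul_of_nonneg_left hut.le hc0.le⟩, ← htt] at h1
      have h2 : c * (u - t) ≠ 0 := mul_ne_zero hc0.ne' (sub_ne_zero.2 hut.ne)
      apply mul_right_cancel₀ h2
      linarith
    have hright : rightDeriv f t = rightDeriv g (c * t) := by
      have h := hf.fstar_eq_fstar_mul hg ha hpsi hc hcg ht.1 hct1
      rw [fstar, fstar, hleft] at h
      exact (div_left_inj' hlg.ne').1 h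
    have hq't : t < q' / c := by rw [lt_div_iff₀ hc0, mul_comm]; exact hq'.1
    refine ⟨min z (min q (q' / c)), fun y hy => ?_, lt_min hz (lt_min hq.1 hq't),
      min_le_left _ _⟩
    rcases le_or_gt y t with hyt | hyt
    · exact hts y ⟨hy.1, hyt⟩
    · have hyq : y ≤ q := hy.2.trans ((min_le_right _ _).trans (min_le_left _ _))
      have hyq' : y ≤ q' / c := hy.2.trans ((min_le_right _ _).trans (min_le_right _ _))
      rw [le_div_iff₀ hc0, mul_comm] at hyq'
      rw [hqf y ⟨hyt.le, hyq⟩, hqg (c * y) ⟨mul_le_mul_of_nonneg_left hyt.le hc0.le, hyq'⟩,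
        ← htt, hright]
      ring
  rcases le_or_gt (firstNode f) x with h | h
  · exact hsub ⟨h, hx.2⟩ x ⟨hx.1, le_rfl⟩
  · exact hbelow x ⟨hx.1, h.le⟩

theorem eq_of_firstNode_le (hf : CornerFun f) (hg : CornerFun g) (ha : alphaF f = alphaF g)
    (hpsi : ∀ s ∈ Ico (0 : ℝ) 1, psi f s = psi g s) (hle : firstNode f ≤ firstNode g) :
    f = g := by
  have hx₁ := hf.firstNode_mem_Ioo
  obtain ⟨c, hc, hcg⟩ : ∃ c, 1 ≤ c ∧ firstNode g = c * firstNode f :=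
    ⟨firstNode g / firstNode f, (one_le_div hx₁.1).2 hle, (div_mul_cancel₀ _ hx₁.1.ne').symm⟩
  have key := fun x => hf.mul_eq_map_mul hg ha hpsi hc hcg (x := x)
  have hc0 : 0 < c := by linarith
  rcases hc.eq_or_lt with rfl | hc1
  · funext x
    by_cases hx : x ∈ Icc (0 : ℝ) 1
    · simpa using key x (by simpa using hx)
    · rw [hf.1.1.eq_id x hx, hg.1.1.eq_id x hx]
  · have h := key (1 / c) ⟨by positivity, le_rfl⟩
    rw [mul_one_div_cancel hc0.ne', hg.1.1.map_one] at h
    have hlt := hf.1.2 (1 / c) ⟨by positivity, (div_lt_one hc0).2 hc1⟩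
    rw [div_lt_iff₀ hc0, mul_comm] at hlt
    exact absurd h hlt.ne'

end CornerFun

/-- **Lemma 4.** A corner function is uniquely specified by `α` and `ψ`. -/
theorem corner_unique (f g : ℝ → ℝ) (hf : CornerFun f) (hg : CornerFun g)
    (ha : alphaF f = alphaF g)
    (hpsi : ∀ s ∈ Set.Ico (0 : ℝ) 1, psi f s = psi g s) :
    f = g := by
  rcases le_total (firstNode f) (firstNode g) with h | h
  · exact hf.eq_of_firstNode_le hg ha hpsi h
  · exact (hg.eq_of_firstNode_le hf ha.symm (fun s hs => (hpsi s hs).symm) h).symm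
end

section
/- Let f be a corner function. Then f is uniquely determined by α_f and φ_f in the following sense: the point (x_f, α_f·x_f) is the first non-smooth point (turning point) of the graph of f, and the slopes of all subsequent affine segments of f are determined by φ_f; hence two corner functions with the same α and the same φ (defined on the same interval [x_f, f(x_f))) are equal. -/
open Set Function

theorem eq_affine_of_locallyAffineAt {f : ℝ → ℝ} {a b : ℝ} (hc : ContinuousOn f (Set.Icc a b))
    (h : ∀ x ∈ Set.Ioo a b, LocallyAffineAt f x) :
    ∃ m : ℝ, ∀ x ∈ Set.Icc a b, f x = f a + m * (x - a) := by
  have hloc : ∀ x ∈ Set.Ioo a b, ∃ c, ∀ᶠ y in nhds x, HasDerivAt f c y := by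
    intro x hx
    obtain ⟨c, d, hcd⟩ := h x hx
    refine ⟨c, ?_⟩
    filter_upwards [hcd.eventually_nhds] with y hy
    have h1 : HasDerivAt (fun z : ℝ => c * z + d) c y := by
      simpa using ((hasDerivAt_id y).const_mul c).add_const d
    exact h1.congr_of_eventuallyEq hy
  have hdiff : ∀ x ∈ Set.Ioo a b, HasDerivAt (deriv f) 0 x := by
    intro x hx
    obtain ⟨c, hcx⟩ := hloc x hx
    refine (hasDerivAt_const x c).congr_of_eventuallyEq ?_
    filter_upwards [hcx] with y hy using hy.deriv
  obtain ⟨m, hm⟩ := isOpen_Ioo.exists_is_const_of_deriv_eq_zero isPreconnected_Ioo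
    (fun x hx => (hdiff x hx).differentiableAt.differentiableWithinAt)
    (fun x hx => (hdiff x hx).deriv)
  refine ⟨m, fun x hx => ?_⟩
  rcases hx.1.eq_or_lt with rfl | hax
  · simp
  obtain ⟨c, hcx, hslope⟩ := exists_deriv_eq_slope f hax (hc.mono (Set.Icc_subset_Icc_right hx.2))
    (fun y hy => by
      obtain ⟨c, hy'⟩ := hloc y ⟨hy.1, hy.2.trans_le hx.2⟩
      exact hy'.self_of_nhds.differentiableAt.differentiableWithinAt)
  rw [hm c ⟨hcx.1, hcx.2.trans_le hx.2⟩, eq_div_iff (sub_pos.2 hax).ne'] at hslope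
  linarith

theorem rightDeriv_eq_of_affine {f : ℝ → ℝ} {a b m : ℝ} (hab : a < b)
    (h : ∀ x ∈ Set.Icc a b, f x = f a + m * (x - a)) : rightDeriv f a = m := by
  have h1 : HasDerivWithinAt (fun x : ℝ => f a + m * (x - a)) m (Set.Ici a) a := by
    simpa using ((((hasDerivAt_id a).sub_const a).const_mul m).const_add (f a)).hasDerivWithinAt
  refine (h1.congr_of_eventuallyEq ?_ (by simp)).derivWithin (uniqueDiffWithinAt_Ici a)
  filter_upwards [Icc_mem_nhdsGE hab] with x hx using h x hx

theorem leftDeriv_eq_of_affine {f : ℝ → ℝ} {a b m : ℝ} (hab : a < b)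
    (h : ∀ x ∈ Set.Icc a b, f x = f a + m * (x - a)) : leftDeriv f b = m := by
  have h1 : HasDerivWithinAt (fun x : ℝ => f a + m * (x - a)) m (Set.Iic b) b := by
    simpa using ((((hasDerivAt_id b).sub_const a).const_mul m).const_add (f a)).hasDerivWithinAt
  refine (h1.congr_of_eventuallyEq ?_ (h b ⟨hab.le, le_rfl⟩)).derivWithin
    (uniqueDiffWithinAt_Iic b)
  filter_upwards [Icc_mem_nhdsLE hab] with x hx using h x hx

theorem IsPLF.exists_affine_of_no_node {f : ℝ → ℝ} (hf : IsPLF f) {a b : ℝ} (ha : 0 ≤ a)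
    (hab : a < b) (hb : b ≤ 1) (h : ∀ x ∈ Set.Ioo a b, ¬ IsNode f x) :
    ∃ m, 0 < m ∧ ∀ x ∈ Set.Icc a b, f x = f a + m * (x - a) := by
  obtain ⟨m, hm⟩ := eq_affine_of_locallyAffineAt (hf.continuousOn.mono (Set.Icc_subset_Icc ha hb))
    (fun x hx => by
      by_contra hna
      exact h x hx ⟨⟨ha.trans_lt hx.1, hx.2.trans_le hb⟩, hna⟩)
  refine ⟨m, ?_, hm⟩
  have hlt := hf.strictMonoOn ⟨ha, hab.le.trans hb⟩ ⟨ha.trans hab.le, hb⟩ hab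
  rw [hm b ⟨hab.le, le_rfl⟩] at hlt
  exact pos_of_mul_pos_left (by linarith) (sub_pos.2 hab).le

theorem IsPLF.exists_affine_right_s16 {f : ℝ → ℝ} (hf : IsPLF f) {t : ℝ} (ht : t ∈ Set.Ico (0 : ℝ) 1) :
    ∃ b > t, ∃ m, 0 < m ∧ ∀ x ∈ Set.Icc t b, f x = f t + m * (x - t) := by
  have hfin : ({x | IsNode f x} \ {t}).Finite := hf.finite_nodes.subset Set.sdiff_subset
  have hmem : ({x | IsNode f x} \ {t})ᶜ ∈ nhdsWithin t (Set.Ici t) :=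
    mem_nhdsWithin_of_mem_nhds (hfin.isClosed.isOpen_compl.mem_nhds (by simp))
  obtain ⟨u, hu, hsub⟩ := mem_nhdsGE_iff_exists_Ico_subset.1 hmem
  refine ⟨min u 1, lt_min hu ht.2, hf.exists_affine_of_no_node ht.1 (lt_min hu ht.2)
    (min_le_right _ _) fun x hx hn => ?_⟩
  exact hsub ⟨hx.1.le, hx.2.trans_le (min_le_left _ _)⟩ ⟨hn, hx.1.ne'⟩

theorem IsPLF.exists_affine_left {f : ℝ → ℝ} (hf : IsPLF f) {t : ℝ} (ht : t ∈ Set.Ioc (0 : ℝ) 1) :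
    ∃ a < t, ∃ m, 0 < m ∧ ∀ x ∈ Set.Icc a t, f x = f a + m * (x - a) := by
  have hfin : ({x | IsNode f x} \ {t}).Finite := hf.finite_nodes.subset Set.sdiff_subset
  have hmem : ({x | IsNode f x} \ {t})ᶜ ∈ nhdsWithin t (Set.Iic t) :=
    mem_nhdsWithin_of_mem_nhds (hfin.isClosed.isOpen_compl.mem_nhds (by simp))
  obtain ⟨u, hu, hsub⟩ := mem_nhdsLE_iff_exists_Ioc_subset.1 hmem
  refine ⟨max u 0, max_lt hu ht.1, hf.exists_affine_of_no_node (le_max_right _ _)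
    (max_lt hu ht.1) ht.2 fun x hx hn => ?_⟩
  exact hsub ⟨(le_max_left _ _).trans_lt hx.1, hx.2.le⟩ ⟨hn, hx.2.ne⟩

theorem IsPLF.leftDeriv_pos {f : ℝ → ℝ} (hf : IsPLF f) {t : ℝ} (ht : t ∈ Set.Ioc (0 : ℝ) 1) :
    0 < leftDeriv f t := by
  obtain ⟨a, hat, m, hm, h⟩ := hf.exists_affine_left ht
  rwa [leftDeriv_eq_of_affine hat h]

theorem IsPLF.fstar_eq_one_s16 {f : ℝ → ℝ} (hf : IsPLF f) {t : ℝ} (ht : t ∈ Set.Ioo (0 : ℝ) 1)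
    (hn : ¬ IsNode f t) : fstar f t = 1 := by
  have hloc : LocallyAffineAt f t := by
    by_contra h
    exact hn ⟨ht, h⟩
  obtain ⟨c, d, hcd⟩ := hloc
  have h1 : HasDerivAt f c t := by
    have h2 : HasDerivAt (fun z : ℝ => c * z + d) c t := by
      simpa using ((hasDerivAt_id t).const_mul c).add_const d
    exact h2.congr_of_eventuallyEq hcd
  have hl : leftDeriv f t = c := h1.hasDerivWithinAt.derivWithin (uniqueDiffWithinAt_Iic t)
  have hr : rightDeriv f t = c := h1.hasDerivWithinAt.derivWithin (uniqueDiffWithinAt_Ici t)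
  have hpos := hf.leftDeriv_pos ⟨ht.1, ht.2.le⟩
  rw [hl] at hpos
  rw [fstar, hl, hr, div_self hpos.ne']

theorem IsPLF.isNode_firstNode {f : ℝ → ℝ} (hf : IsPLF f) (h : HasNode f) :
    IsNode f (firstNode f) :=
  Set.Nonempty.csInf_mem h hf.finite_nodes

theorem IsPLF.firstNode_le {f : ℝ → ℝ} (hf : IsPLF f) {x : ℝ} (hx : IsNode f x) :
    firstNode f ≤ x :=
  csInf_le hf.finite_nodes.bddBelow hx

theorem IsPLF.eq_alphaF_mul {f : ℝ → ℝ} (hf : IsPLF f) (h : HasNode f) {x : ℝ}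
    (hx : x ∈ Set.Icc 0 (firstNode f)) : f x = alphaF f * x := by
  have hn := (hf.isNode_firstNode h).1
  obtain ⟨m, -, hm⟩ := hf.exists_affine_of_no_node le_rfl hn.1 hn.2.le
    (fun y hy hy' => (hf.firstNode_le hy').not_gt hy.2)
  rw [alphaF, leftDeriv_eq_of_affine hn.1 hm, hm x hx, hf.map_zero]
  ring

theorem IsPLF.mapsTo_Ioo {f : ℝ → ℝ} (hf : IsPLF f) :
    Set.MapsTo f (Set.Ioo 0 1) (Set.Ioo 0 1) := by
  intro x hx
  have hx' : x ∈ Set.Icc (0 : ℝ) 1 := ⟨hx.1.le, hx.2.le⟩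
  have h0 := hf.strictMonoOn (by simp) hx' hx.1
  have h1 := hf.strictMonoOn hx' (by simp) hx.2
  rw [hf.map_zero] at h0
  rw [hf.map_one] at h1
  exact ⟨h0, h1⟩

theorem CornerFun.fstar_eq_one_s16 {f : ℝ → ℝ} (hf : CornerFun f) {x : ℝ}
    (hx : x ∈ Set.Ico (f (firstNode f)) 1) : fstar f x = 1 := by
  have hn := (hf.1.1.isNode_firstNode hf.2.1).1
  refine hf.1.1.fstar_eq_one_s16 ⟨(hf.1.1.mapsTo_Ioo hn).1.trans_le hx.1, hx.2⟩ fun h => ?_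
  exact (hf.2.2 x h).2.not_ge hx.1

theorem CornerFun.phi_eq_fstar_s16 {f : ℝ → ℝ} (hf : CornerFun f) {x : ℝ}
    (hx : x ∈ Set.Ico (firstNode f) 1) : phi f x = fstar f x := by
  have hn := (hf.1.1.isNode_firstNode hf.2.1).1
  have hiter : ∀ n : ℕ, f^[n] x ∈ Set.Ico (firstNode f) 1 := by
    intro n
    induction n with
    | zero => exact hx
    | succ n ih =>
      rw [Function.iterate_succ_apply']
      have hI : f^[n] x ∈ Set.Ioo (0 : ℝ) 1 := ⟨hn.1.trans_le ih.1, ih.2⟩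
      exact ⟨ih.1.trans (hf.1.2 _ hI).le, (hf.1.1.mapsTo_Ioo hI).2⟩
  rw [phi, tprod_eq_mulSingle 0, Function.iterate_zero_apply]
  intro n hn0
  obtain ⟨k, rfl⟩ := Nat.exists_eq_succ_of_ne_zero hn0
  refine hf.fstar_eq_one_s16 ⟨?_, (hiter _).2⟩
  rw [Function.iterate_succ_apply']
  exact hf.1.1.strictMonoOn.monotoneOn ⟨hn.1.le, hn.2.le⟩
    ⟨hn.1.le.trans (hiter k).1, (hiter k).2.le⟩ (hiter k).1

theorem IsPLF.exists_gt_eqOn {f g : ℝ → ℝ} (hf : IsPLF f) (hg : IsPLF g) {t : ℝ}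
    (ht : t ∈ Set.Ioo (0 : ℝ) 1) (heq : Set.EqOn f g (Set.Icc 0 t))
    (hstar : fstar f t = fstar g t) : ∃ b > t, Set.EqOn f g (Set.Icc t b) := by
  have hft : f t = g t := heq ⟨ht.1.le, le_rfl⟩
  have hl : leftDeriv f t = leftDeriv g t := by
    refine Filter.EventuallyEq.derivWithin_eq ?_ hft
    filter_upwards [Icc_mem_nhdsLE ht.1] with x hx using heq hx
  have hr : rightDeriv f t = rightDeriv g t := by
    have hne := (hg.leftDeriv_pos ⟨ht.1, ht.2.le⟩).ne'
    rw [fstar, fstar, hl] at hstar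
    exact (div_left_inj' hne).1 hstar
  obtain ⟨b, hb, m, -, hm⟩ := hf.exists_affine_right_s16 ⟨ht.1.le, ht.2⟩
  obtain ⟨c, hc, k, -, hk⟩ := hg.exists_affine_right_s16 ⟨ht.1.le, ht.2⟩
  rw [rightDeriv_eq_of_affine hb hm, rightDeriv_eq_of_affine hc hk] at hr
  refine ⟨min b c, lt_min hb hc, fun x hx => ?_⟩
  rw [hm x ⟨hx.1, hx.2.trans (min_le_left _ _)⟩, hk x ⟨hx.1, hx.2.trans (min_le_right _ _)⟩, hr,
    hft]

/-- Two piecewise linear homeomorphisms that agree on `[0, a]` and have the same jumps of slope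
on `[a, 1)` are equal. -/
theorem IsPLF.eq_of_fstar_eq {f g : ℝ → ℝ} (hf : IsPLF f) (hg : IsPLF g) {a : ℝ}
    (ha : a ∈ Set.Ioo (0 : ℝ) 1) (heq : Set.EqOn f g (Set.Icc 0 a))
    (hstar : ∀ x ∈ Set.Ico a 1, fstar f x = fstar g x) : f = g := by
  have hle : ∀ t ∈ Set.Icc a 1, Set.EqOn f g (Set.Icc 0 t) := by
    by_contra hcon
    push Not at hcon
    obtain ⟨t, ht, hne⟩ := hcon
    obtain ⟨y, hy, hyne⟩ : ∃ y ∈ Set.Icc 0 t, f y ≠ g y := by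
      simpa [Set.EqOn, and_assoc] using hne
    let S : Set ℝ := {x | x ∈ Set.Icc a 1 ∧ f x ≠ g x}
    have hyS : y ∈ S := by
      refine ⟨⟨?_, hy.2.trans ht.2⟩, hyne⟩
      by_contra h
      exact hyne (heq ⟨hy.1, (not_le.1 h).le⟩)
    have hbdd : BddBelow S := ⟨a, fun x hx => hx.1.1⟩
    have has : a ≤ sInf S := le_csInf ⟨y, hyS⟩ fun x hx => hx.1.1
    have hsy : sInf S ≤ y := csInf_le hbdd hyS
    have hbelow : ∀ x ∈ Set.Ico 0 (sInf S), f x = g x := by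
      intro x hx
      by_contra h
      rcases le_total x a with hxa | hxa
      · exact h (heq ⟨hx.1, hxa⟩)
      · exact (csInf_le hbdd ⟨⟨hxa, hx.2.le.trans (hsy.trans hyS.1.2)⟩, h⟩).not_gt hx.2
    have h0s : 0 < sInf S := ha.1.trans_le has
    have hs1 : sInf S ≤ 1 := hsy.trans hyS.1.2
    have hcl : Set.EqOn f g (Set.Icc 0 (sInf S)) := by
      refine Set.EqOn.of_subset_closure (s := Set.Ico 0 (sInf S)) hbelow
        (hf.continuousOn.mono (Set.Icc_subset_Icc_right hs1))
        (hg.continuousOn.mono (Set.Icc_subset_Icc_right hs1)) Set.Ico_subset_Icc_self ?_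
      rw [closure_Ico h0s.ne]
    have hlt : sInf S < 1 := by
      refine hs1.lt_of_ne fun h => hyne (hcl ⟨hy.1, ?_⟩)
      rw [h]
      exact hyS.1.2
    obtain ⟨b, hb, hbeq⟩ := hf.exists_gt_eqOn hg ⟨h0s, hlt⟩ hcl (hstar _ ⟨has, hlt⟩)
    obtain ⟨z, hz, hzb⟩ := exists_lt_of_csInf_lt ⟨y, hyS⟩ hb
    exact hz.2 (hbeq ⟨csInf_le hbdd hz, hzb.le⟩)
  ext x
  by_cases hx : x ∈ Set.Icc (0 : ℝ) 1
  · exact hle 1 ⟨ha.2.le, le_rfl⟩ hx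
  · rw [hf.eq_id x hx, hg.eq_id x hx]

/-- A corner function is uniquely determined by `α_f` and `φ_f`: the point
`(x_f, α_f · x_f)` is the first turning point of the graph of `f` (i.e.
`f x_f = α_f · x_f`), and two corner functions with the same `α` and the same `φ` on
the same interval `[x_f, f x_f)` are equal. -/
theorem corner_determined_by_alpha_phi (f g : ℝ → ℝ)
    (hf : CornerFun f) (hg : CornerFun g) :
    f (firstNode f) = alphaF f * firstNode f ∧
    (alphaF f = alphaF g → firstNode f = firstNode g →
      f (firstNode f) = g (firstNode g) →
      (∀ x ∈ Set.Ico (firstNode f) (f (firstNode f)), phi f x = phi g x) →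
      f = g) := by
  have hn := (hf.1.1.isNode_firstNode hf.2.1).1
  refine ⟨hf.1.1.eq_alphaF_mul hf.2.1 ⟨hn.1.le, le_rfl⟩, fun hα hx hfx hφ => ?_⟩
  refine hf.1.1.eq_of_fstar_eq hg.1.1 hn (fun x hx' => ?_) fun x hx' => ?_
  · rw [hf.1.1.eq_alphaF_mul hf.2.1 hx', hα, hg.1.1.eq_alphaF_mul hg.2.1 (hx ▸ hx')]
  · rcases lt_or_ge x (f (firstNode f)) with hlt | hge
    · rw [← hf.phi_eq_fstar_s16 hx', ← hg.phi_eq_fstar_s16 (hx ▸ hx')]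
      exact hφ x ⟨hx'.1, hlt⟩
    · rw [hf.fstar_eq_one_s16 ⟨hge, hx'.2⟩, hg.fstar_eq_one_s16 ⟨hfx ▸ hge, hx'.2⟩]
end
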